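/- Let X be a nonempty set. A nonempty family 𝒜 of subsets of X is an inclusion hyperspace on X if and only if there exist a nonempty index set I and, for each i ∈ I, a nonempty set 𝔘_i of ultrafilters on X such that 𝒜 = ⋃_{i∈I} ⋂_{𝒰∈𝔘_i} {A ⊆ X : A ∈ 𝒰}. In other words, the inclusion hyperspaces on X are exactly the members of the smallest subfamily of the double power set of X that contains all ultrafilters on X and is closed under arbitrary nonempty unions and arbitrary nonempty intersections. -/

import Mathlib

variable {X : Type}

/-- An inclusion hyperspace on a set `X`. -/
def IsIH (𝒜 : Set (Set X)) : Prop :=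
  𝒜.Nonempty ∧ (∀ A ∈ 𝒜, A.Nonempty) ∧ ∀ A ∈ 𝒜, ∀ B : Set X, A ⊆ B → B ∈ 𝒜

theorem stmt4 [Nonempty X] (𝒜 : Set (Set X)) :
    IsIH 𝒜 ↔
      ∃ (I : Type) (_ : Nonempty I) (𝔘 : I → Set (Ultrafilter X)),
        (∀ i, (𝔘 i).Nonempty) ∧
        𝒜 = ⋃ i, ⋂ U ∈ 𝔘 i, {A : Set X | A ∈ U} := by
  constructor
  · rintro ⟨hne, hA, hmono⟩
    refine ⟨𝒜, hne.to_subtype, fun A => {U | (A : Set X) ∈ U}, ?_, ?_⟩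
    · rintro ⟨A, h⟩
      obtain ⟨x, hx⟩ := hA A h
      exact ⟨pure x, Ultrafilter.mem_pure.2 hx⟩
    · ext B
      simp only [Set.mem_iUnion, Set.mem_iInter, Set.mem_ofPred_eq]
      constructor
      · exact fun hB => ⟨⟨B, hB⟩, fun U hU => hU⟩
      · rintro ⟨⟨A, h⟩, hAB⟩
        exact hmono A h B fun x hx =>
          Ultrafilter.mem_pure.1 (hAB (pure x) (Ultrafilter.mem_pure.2 hx))
  · rintro ⟨I, ⟨i⟩, 𝔘, hne, rfl⟩
    simp only [IsIH, Set.Nonempty, Set.mem_iUnion, Set.mem_iInter, Set.mem_ofPred_eq]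
    refine ⟨⟨Set.univ, i, fun U _ => Filter.univ_mem⟩, ?_, ?_⟩
    · rintro A ⟨j, hj⟩
      obtain ⟨U, hU⟩ := hne j
      exact U.nonempty_of_mem (hj U hU)
    · rintro A ⟨j, hj⟩ B hAB
      exact ⟨j, fun U hU => Filter.mem_of_superset (hj U hU) hAB⟩
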